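/- Fix an integer d ≥ 13, a ∈ (0,1), and λ_∞, c_∞ ∈ ℝ. Suppose Ψ_∞ : ℝ → ℝ is a C² solution of equation (E_{λ_∞}) with Ψ_∞(t) − √(d−3)·(1 − λ_∞ (4d−10)^{-1} e^{2t}) = O(e^{4t}) as t → −∞. Suppose that for each (λ,c) in a neighborhood of (λ_∞,c_∞), Ψ_{λ,c} : ℝ → ℝ is a C² solution of equation (E_λ), differentiable in c with ρ_{λ,c} := ∂_c Ψ_{λ,c} a C² solution of the linearized equation (M_{Ψ_{λ,c},λ}); write ρ_∞ := ρ_{λ_∞,c_∞}. Assume: (i) there is C₁ > 0 such that for all (λ,c) near (λ_∞,c_∞), sup over t ∈ [0,∞) of (|Ψ_{λ,c}(t) − Ψ_∞(t)| + |ρ_{λ,c}(t) − ρ_∞(t)| + |ρ_{λ,c}'(t) − ρ_∞'(t)|) ≤ C₁(|λ − λ_∞| + |c − c_∞|); (ii) there exists L_∞ ≠ 0 with ρ_∞(t) − L_∞ e^{κ₋ t} = O(e^{κ₊ t} + e^{(κ₋+2)t}) as t → −∞. Then there exist b₀ > 0, C₀ > 0, and ε₀ > 0 such that for every ε ∈ (0,ε₀),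 every b ≥ b₀, and every (λ,c) with |λ − λ_∞| + |c − c_∞| ≤ ε b^{κ₋(1−a)}, one has |ρ_{λ,c}(t) − ρ_∞(t)| + |ρ_{λ,c}'(t) − ρ_∞'(t)| ≤ C₀ ε e^{κ₋ t} for every t ∈ [(a−1)·log b, 0]. -/

import Mathlib

open Filter Asymptotics Topology Set

/-- The characteristic exponent `κ₋ = (-(d-4) - √(d²-16d+40))/2`. -/
noncomputable def kappam (d : ℤ) : ℝ :=
  (-((d : ℝ) - 4) - Real.sqrt ((d : ℝ) ^ 2 - 16 * (d : ℝ) + 40)) / 2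

/-- The characteristic exponent `κ₊ = (-(d-4) + √(d²-16d+40))/2`. -/
noncomputable def kappap (d : ℤ) : ℝ :=
  (-((d : ℝ) - 4) + Real.sqrt ((d : ℝ) ^ 2 - 16 * (d : ℝ) + 40)) / 2


set_option maxHeartbeats 1000000 in
/-- Backward Gronwall estimate for a perturbation of `(D-n)(D-m)`. -/
theorem aux_core (m n : ℝ) (hm : m < 0) (hmn : m < n) :
    ∃ K > (0 : ℝ), ∃ k > (0 : ℝ), ∀ (y y' f : ℝ → ℝ) (T α β G : ℝ), T ≤ 0 → 0 ≤ α → 0 ≤ β → 0 < G →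
      (∀ t, HasDerivAt y (y' t) t) →
      (∀ t, HasDerivAt y' (f t + (m + n) * y' t - m * n * y t) t) →
      (∀ t ∈ Ioo T 0, |f t| ≤ (α * Real.exp (2 * t) + β * Real.exp (m * (t - T))) *
        (|y t| + G * Real.exp (m * t))) →
      |y T| + |y' T| ≤ K * (|y 0| + |y' 0| + G) * Real.exp (k * (α + β)) * Real.exp (m * T) := by
  set σ := n - m with hσ
  have hσ0 : 0 < σ := by rw [hσ]; linarith
  set c := 4 / σ + 2 with hc
  have hc0 : 0 < c := by positivity
  set r := 1 + 1 / (-m) with hr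
  have hm' : 0 < -m := by linarith
  have hr0 : 0 < r := by positivity
  refine ⟨(2 / σ + 1 + |n| * (2 / σ)) * (2 + |m| + |n|), by positivity, c * r, by positivity, ?_⟩
  intro y y' f T α β G hT hα hβ hG hy hy' hf
  set P : ℝ → ℝ := fun t => Real.exp (-m * t) * (y' t - n * y t) with hP
  set Q : ℝ → ℝ := fun t => Real.exp (-m * t) * (y' t - m * y t) with hQ
  have hexp : ∀ t, HasDerivAt (fun t => Real.exp (-m * t)) (Real.exp (-m * t) * (-m)) t := by
    intro t
    simpa using ((hasDerivAt_id t).const_mul (-m)).exp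
  have dP : ∀ t, HasDerivAt P (Real.exp (-m * t) * f t) t := by
    intro t
    have := (hexp t).mul ((hy' t).sub ((hy t).const_mul n))
    refine this.congr_deriv ?_
    simp only [Pi.sub_apply]
    ring
  have dQ : ∀ t, HasDerivAt Q (Real.exp (-m * t) * f t + σ * Q t) t := by
    intro t
    have := (hexp t).mul ((hy' t).sub ((hy t).const_mul m))
    refine this.congr_deriv ?_
    simp only [hQ, hσ, Pi.sub_apply]
    ring
  have hQP : ∀ t, Real.exp (-m * t) * y t = (Q t - P t) / σ := by
    intro t
    simp only [hQ, hP]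
    field_simp
    rw [hσ]; ring
  have hee : ∀ t, Real.exp (-m * t) * Real.exp (m * t) = 1 := by
    intro t; rw [← Real.exp_add]; simp
  set h : ℝ → ℝ := fun t => α * Real.exp (2 * t) + β * Real.exp (m * (t - T)) with hh
  set H : ℝ → ℝ := fun t => α * Real.exp (2 * t) / 2 + β * Real.exp (m * (t - T)) / m with hH
  have dH : ∀ t, HasDerivAt H (h t) t := by
    intro t
    have h1 : HasDerivAt (fun t => Real.exp (2 * t)) (Real.exp (2 * t) * 2) t := by
      simpa using ((hasDerivAt_id t).const_mul 2).exp
    have h2 : HasDerivAt (fun t => Real.exp (m * (t - T))) (Real.exp (m * (t - T)) * m) t := by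
      simpa using (((hasDerivAt_id t).sub_const T).const_mul m).exp
    refine (((h1.const_mul α).div_const 2).add ((h2.const_mul β).div_const m)).congr_deriv ?_
    simp only [hh]
    have hm0 : m ≠ 0 := hm.ne
    field_simp
  set F : ℝ → ℝ := fun t => P t ^ 2 + Q t ^ 2 + G ^ 2 with hF
  set W : ℝ → ℝ := fun t => Real.exp (c * H t) * F t with hW
  have dW : ∀ t, HasDerivAt W (Real.exp (c * H t) * (c * h t * F t
      + (2 * P t * (Real.exp (-m * t) * f t) + 2 * Q t * (Real.exp (-m * t) * f t + σ * Q t)))) t := by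
    intro t
    have h1 := ((dH t).const_mul c).exp
    have h2 := (((dP t).pow 2).add ((dQ t).pow 2)).add_const (G ^ 2)
    refine (h1.mul h2).congr_deriv ?_
    simp only [hF, Pi.add_apply, Pi.pow_apply]
    push_cast
    ring
  have hmono : MonotoneOn W (Icc T 0) := by
    apply monotoneOn_of_deriv_nonneg (convex_Icc T 0)
    · exact fun t _ => (dW t).continuousAt.continuousWithinAt
    · exact fun t _ => (dW t).differentiableAt.differentiableWithinAt
    · intro t ht
      rw [interior_Icc] at ht
      rw [(dW t).deriv]
      apply mul_nonneg (Real.exp_pos _).le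
      have hh0 : 0 ≤ h t := by simp only [hh]; positivity
      have hφ : |Real.exp (-m * t) * f t| ≤ h t * ((|P t| + |Q t|) / σ + G) := by
        rw [abs_mul, abs_of_pos (Real.exp_pos _)]
        calc Real.exp (-m * t) * |f t| ≤ Real.exp (-m * t) * (h t * (|y t| + G * Real.exp (m * t))) := by
              gcongr; exact hf t ht
          _ = h t * (|Real.exp (-m * t) * y t| + G * (Real.exp (-m * t) * Real.exp (m * t))) := by
              rw [abs_mul, abs_of_pos (Real.exp_pos _)]; ring
          _ = h t * (|Q t - P t| / σ + G) := by
              rw [hee, hQP, abs_div, abs_of_pos hσ0]; ring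
          _ ≤ _ := by
              gcongr
              have := abs_sub (Q t) (P t)
              linarith
      set φ := Real.exp (-m * t) * f t
      have h1 : -(2 * (|P t| + |Q t|) * |φ|) ≤ 2 * P t * φ + 2 * Q t * φ := by
        have a1 := neg_abs_le (P t * φ)
        have a2 := neg_abs_le (Q t * φ)
        rw [abs_mul] at a1 a2
        linarith
      have h2 : 2 * (|P t| + |Q t|) * |φ| ≤ 2 * (|P t| + |Q t|) * (h t * ((|P t| + |Q t|) / σ + G)) := by
        gcongr
      have h3 : 2 * (|P t| + |Q t|) * (h t * ((|P t| + |Q t|) / σ + G)) ≤ c * h t * F t := by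
        have hs : (|P t| + |Q t|) ^ 2 ≤ 2 * (P t ^ 2 + Q t ^ 2) := by
          rw [← sq_abs (P t), ← sq_abs (Q t)]
          nlinarith [sq_nonneg (|P t| - |Q t|)]
        have hs1 : (2 * (|P t| + |Q t|)) * ((|P t| + |Q t|) / σ + G) ≤ c * F t := by
          have e1 : (2 * (|P t| + |Q t|)) * ((|P t| + |Q t|) / σ + G) =
            (2 / σ) * (|P t| + |Q t|) ^ 2 + 2 * (|P t| + |Q t|) * G := by ring
          have e2 : (2 / σ) * (|P t| + |Q t|) ^ 2 ≤ (2 / σ) * (2 * F t) := by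
            gcongr
            simp only [hF]; nlinarith [sq_nonneg G]
          have e3 : 2 * (|P t| + |Q t|) * G ≤ 2 * F t := by
            simp only [hF]
            nlinarith [sq_nonneg (|P t| + |Q t| - G), sq_nonneg G]
          rw [e1, hc]
          calc _ ≤ (2 / σ) * (2 * F t) + 2 * F t := add_le_add e2 e3
            _ = _ := by ring
        nlinarith
      have h4 : 0 ≤ 2 * Q t * (σ * Q t) := by
        have : 2 * Q t * (σ * Q t) = 2 * σ * (Q t)^2 := by ring
        rw [this]; positivity
      linarith [mul_add (2 * Q t) φ (σ * Q t)]
  have hWT : W T ≤ W 0 := hmono (left_mem_Icc.2 hT) (right_mem_Icc.2 hT) hT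
  have hHT : β / m ≤ H T := by
    simp only [hH, sub_self, mul_zero, Real.exp_zero, mul_one]
    have : 0 ≤ α * Real.exp (2 * T) / 2 := by positivity
    linarith
  have hH0 : H 0 ≤ α := by
    simp only [hH, mul_zero, Real.exp_zero, mul_one]
    have : β * Real.exp (m * (0 - T)) / m ≤ 0 := by
      apply div_nonpos_of_nonneg_of_nonpos _ hm.le
      positivity
    linarith
  have hHH : H 0 - H T ≤ r * (α + β) := by
    have : α - β / m ≤ r * (α + β) := by
      have e : r * (α + β) = α - β / m + (β + α * (1/(-m))) := by
        rw [hr]; field_simp; ring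
      rw [e]
      have : 0 ≤ α * (1/(-m)) := by positivity
      linarith
    linarith
  have hFT : F T ≤ Real.exp (c * r * (α + β)) * F 0 := by
    have e0 : F T = Real.exp (-(c * H T)) * W T := by
      simp only [hW]; rw [← mul_assoc, ← Real.exp_add]; simp
    have F0 : 0 ≤ F 0 := by simp only [hF]; positivity
    calc F T = Real.exp (-(c * H T)) * W T := e0
      _ ≤ Real.exp (-(c * H T)) * W 0 := by gcongr
      _ = Real.exp (c * (H 0 - H T)) * F 0 := by
        simp only [hW]; rw [← mul_assoc, ← Real.exp_add]; congr 2; ring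
      _ ≤ _ := by
        apply mul_le_mul_of_nonneg_right _ F0
        apply Real.exp_le_exp.2
        rw [mul_assoc]
        exact mul_le_mul_of_nonneg_left hHH hc0.le
  set X := Real.exp (c * r * (α + β)) with hX
  have hX1 : 1 ≤ X := by
    rw [hX]; apply Real.one_le_exp; positivity
  set S := (2 + |m| + |n|) * (|y 0| + |y' 0| + G) with hS
  have hS0 : 0 ≤ S := by positivity
  have hF0 : F 0 ≤ S ^ 2 := by
    have hP0 : |P 0| ≤ |y' 0| + |n| * |y 0| := by
      simp only [hP, mul_zero, Real.exp_zero, one_mul]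
      rw [← abs_mul]; exact abs_sub _ _
    have hQ0 : |Q 0| ≤ |y' 0| + |m| * |y 0| := by
      simp only [hQ, mul_zero, Real.exp_zero, one_mul]
      rw [← abs_mul]; exact abs_sub _ _
    have : |P 0| + |Q 0| + G ≤ S := by
      rw [hS]
      have := abs_nonneg m
      have := abs_nonneg n
      have := abs_nonneg (y 0)
      have := abs_nonneg (y' 0)
      have : 0 ≤ |m| * |y' 0| := by positivity
      have : 0 ≤ |n| * |y' 0| := by positivity
      have : 0 ≤ |m| * G := by positivity
      have : 0 ≤ |n| * G := by positivity
      linarith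
    have h1 : F 0 ≤ (|P 0| + |Q 0| + G) ^ 2 := by
      simp only [hF]
      rw [← sq_abs (P 0), ← sq_abs (Q 0)]
      have : 0 ≤ |P 0| * |Q 0| := by positivity
      have : 0 ≤ |P 0| * G := by positivity
      have : 0 ≤ |Q 0| * G := by positivity
      nlinarith
    exact h1.trans (by gcongr)
  have hFXS : F T ≤ (X * S) ^ 2 := by
    calc F T ≤ X * F 0 := hFT
      _ ≤ X * S ^ 2 := by gcongr
      _ ≤ X ^ 2 * S ^ 2 := by gcongr; nlinarith
      _ = _ := by ring
  have hPT : |P T| ≤ X * S := by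
    apply abs_le_of_sq_le_sq _ (by positivity)
    exact le_trans (by simp only [hF]; nlinarith [sq_nonneg (Q T), sq_nonneg G]) hFXS
  have hQT : |Q T| ≤ X * S := by
    apply abs_le_of_sq_le_sq _ (by positivity)
    exact le_trans (by simp only [hF]; nlinarith [sq_nonneg (P T), sq_nonneg G]) hFXS
  have hyT : |Real.exp (-m * T) * y T| ≤ (2 / σ) * (X * S) := by
    rw [hQP, abs_div, abs_of_pos hσ0, div_le_iff₀ hσ0]
    have := abs_sub (Q T) (P T)
    have e : 2 / σ * (X * S) * σ = 2 * (X * S) := by field_simp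
    rw [e]; linarith
  have hyT' : |Real.exp (-m * T) * y' T| ≤ X * S + |n| * ((2 / σ) * (X * S)) := by
    have e : Real.exp (-m * T) * y' T = P T + n * (Real.exp (-m * T) * y T) := by
      simp only [hP]; ring
    rw [e]
    refine (abs_add_le _ _).trans ?_
    rw [abs_mul n]
    gcongr
  have e : |y T| + |y' T| = (|Real.exp (-m * T) * y T| + |Real.exp (-m * T) * y' T|) * Real.exp (m * T) := by
    rw [abs_mul, abs_mul, abs_of_pos (Real.exp_pos _), ← mul_add]
    linear_combination -(|y T| + |y' T|) * hee T
  rw [e]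
  gcongr
  calc _ ≤ (2 / σ) * (X * S) + (X * S + |n| * ((2 / σ) * (X * S))) := add_le_add hyT hyT'
    _ = _ := by rw [hS]; ring

theorem aux_step1 (m n : ℝ) (hm : m < 0) (hmn : m < n) (k₀ B C₀ : ℝ) (hk₀ : 0 ≤ k₀) (hB : 0 ≤ B)
    (hC₀ : 0 ≤ C₀) :
    ∃ M > (0 : ℝ), ∃ ε₁ > (0 : ℝ), ∀ ε ∈ Ioo 0 ε₁, ∀ T ≤ 0, ∀ (w w' V Φ : ℝ → ℝ) (l : ℝ),
      (∀ t, HasDerivAt w (w' t) t) →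
      (∀ t, HasDerivAt w' ((-(V t * w t) - 3 * Φ t * w t ^ 2 - w t ^ 3
        - l * Real.exp (2 * t) * (Φ t + w t)) + (m + n) * w' t - m * n * w t) t) →
      (∀ t ≤ 0, |V t| ≤ k₀ * Real.exp (2 * t)) → (∀ t ≤ 0, |Φ t| ≤ B) →
      |l| ≤ ε * Real.exp (-m * T) → |w 0| + |w' 0| ≤ C₀ * (ε * Real.exp (-m * T)) →
      ∀ t ∈ Icc T 0, |w t| ≤ M * ε * Real.exp (m * (t - T)) ∧ M * ε * Real.exp (m * (t - T)) ≤ 1 := by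
  obtain ⟨K, hK, k, hk, hcore⟩ := aux_core m n hm hmn
  set M := K * (C₀ + 1) * Real.exp (k * (k₀ + B + 1 + 1)) + 1 with hM
  have hM0 : 0 < M := by positivity
  refine ⟨M, hM0, 1 / ((3 * B + 1) * M), by positivity, ?_⟩
  intro ε hε T hT w w' V Φ l hw hw' hV hΦ hl h0
  have hε0 : 0 < ε := hε.1
  have hε1 : (3 * B + 1) * M * ε ≤ 1 := by
    have := hε.2.le
    rw [le_div_iff₀ (by positivity)] at this
    linarith
  have hMε : M * ε ≤ 1 := by
    have : 0 ≤ 3 * B * (M * ε) := by positivity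
    nlinarith
  have hle1 : ∀ t ∈ Icc T 0, M * ε * Real.exp (m * (t - T)) ≤ 1 := by
    intro t ht
    have : Real.exp (m * (t - T)) ≤ 1 := by
      apply Real.exp_le_one_iff.2
      exact mul_nonpos_of_nonpos_of_nonneg hm.le (by linarith [ht.1])
    calc _ ≤ M * ε * 1 := by gcongr
      _ ≤ 1 := by linarith
  have hwc : Continuous w := continuous_iff_continuousAt.2 fun t => (hw t).continuousAt
  intro t ht
  refine ⟨?_, hle1 t ht⟩
  by_contra hcon
  push Not at hcon
  set Z := {s | s ∈ Icc T 0 ∧ M * ε * Real.exp (m * (s - T)) ≤ |w s|} with hZ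
  have hZc : IsCompact Z := by
    have : Z = Icc T 0 ∩ {s | M * ε * Real.exp (m * (s - T)) ≤ |w s|} := rfl
    rw [this]
    apply isCompact_Icc.inter_right
    exact isClosed_le (by fun_prop) (by fun_prop)
  obtain ⟨s, hs, hmax⟩ := hZc.exists_isGreatest ⟨t, ht, hcon.le⟩
  have hlt : ∀ u ∈ Ioo s 0, |w u| ≤ M * ε * Real.exp (m * (u - T)) := by
    intro u hu
    by_contra h
    push Not at h
    have := hmax (show u ∈ Z from ⟨⟨hs.1.1.trans hu.1.le, hu.2.le⟩, h.le⟩)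
    linarith [hu.1]
  have hG : 0 < ε * Real.exp (-m * T) := by positivity
  have key := hcore w w' _ s (k₀ + B + 1) 1 (ε * Real.exp (-m * T)) hs.1.2 (by positivity) (by norm_num)
    hG hw hw' ?_
  · have e1 : K * (|w 0| + |w' 0| + ε * Real.exp (-m * T)) * Real.exp (k * (k₀ + B + 1 + 1))
        * Real.exp (m * s) ≤ (M - 1) * ε * Real.exp (m * (s - T)) := by
      have e2 : (M - 1) * ε * Real.exp (m * (s - T)) =
          K * (C₀ * (ε * Real.exp (-m * T)) + ε * Real.exp (-m * T)) * Real.exp (k * (k₀ + B + 1 + 1))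
            * Real.exp (m * s) := by
        have : Real.exp (m * (s - T)) = Real.exp (-m * T) * Real.exp (m * s) := by
          rw [← Real.exp_add]; congr 1; ring
        rw [this, hM]; ring
      rw [e2]
      gcongr
    have h3 := hs.2
    have h4 := abs_nonneg (w' s)
    have h5 : 0 < ε * Real.exp (m * (s - T)) := by positivity
    nlinarith
  · intro u hu
    have hu0 : u ≤ 0 := hu.2.le
    have hTu : u ∈ Icc T 0 := ⟨hs.1.1.trans hu.1.le, hu0⟩
    have hwu := hlt u hu
    have hw1 : |w u| ≤ 1 := hwu.trans (hle1 u hTu)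
    have he : Real.exp (m * (u - T)) ≤ Real.exp (m * (u - s)) := by
      apply Real.exp_le_exp.2
      nlinarith [hs.1.1]
    have hem : 1 ≤ Real.exp (m * u) := Real.one_le_exp (mul_nonneg_of_nonpos_of_nonpos hm.le hu0)
    have a1 : |V u * w u| ≤ k₀ * Real.exp (2 * u) * |w u| := by
      rw [abs_mul]; gcongr; exact hV u hu0
    have a2 : |3 * Φ u * w u ^ 2| ≤ 3 * B * (|w u| * |w u|) := by
      rw [abs_mul, abs_mul, abs_pow, abs_of_pos (by norm_num : (0:ℝ) < 3), pow_two]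
      gcongr; exact hΦ u hu0
    have a3 : |w u ^ 3| ≤ |w u| * |w u| := by
      rw [abs_pow, pow_three]
      have : |w u| * |w u| ≤ |w u| := by nlinarith [abs_nonneg (w u)]
      gcongr
    have a4 : |l * Real.exp (2 * u) * (Φ u + w u)| ≤ ε * Real.exp (-m * T) * Real.exp (2 * u) * (B + 1) := by
      rw [abs_mul, abs_mul, abs_of_pos (Real.exp_pos _)]
      gcongr
      exact (abs_add_le _ _).trans (add_le_add (hΦ u hu0) hw1)
    have a5 : (3 * B + 1) * (|w u| * |w u|) ≤ Real.exp (m * (u - s)) * |w u| := by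
      calc (3 * B + 1) * (|w u| * |w u|) ≤ (3 * B + 1) * ((M * ε * Real.exp (m * (u - T))) * |w u|) := by gcongr
        _ = ((3 * B + 1) * M * ε) * (Real.exp (m * (u - T)) * |w u|) := by ring
        _ ≤ 1 * (Real.exp (m * (u - s)) * |w u|) := by gcongr
        _ = _ := by ring
    have a6 : ε * Real.exp (-m * T) * Real.exp (2 * u) * (B + 1) ≤
        (B + 1) * Real.exp (2 * u) * (ε * Real.exp (-m * T) * Real.exp (m * u)) := by
      have : 0 ≤ ε * Real.exp (-m * T) * Real.exp (2 * u) * (B + 1) := by positivity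
      nlinarith
    have tri : |(-(V u * w u) - 3 * Φ u * w u ^ 2 - w u ^ 3 - l * Real.exp (2 * u) * (Φ u + w u))| ≤
        |V u * w u| + |3 * Φ u * w u ^ 2| + |w u ^ 3| + |l * Real.exp (2 * u) * (Φ u + w u)| := by
      refine (abs_sub _ _).trans ?_
      gcongr
      refine (abs_sub _ _).trans ?_
      gcongr
      refine (abs_sub _ _).trans ?_
      rw [abs_neg]
    have p1 : 0 ≤ (B + 1) * Real.exp (2 * u) * |w u| := by positivity
    have p2 : 0 ≤ k₀ * Real.exp (2 * u) * (ε * Real.exp (-m * T) * Real.exp (m * u)) := by positivity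
    have p3 : 0 ≤ Real.exp (m * (u - s)) * (ε * Real.exp (-m * T) * Real.exp (m * u)) := by positivity
    nlinarith

theorem aux_step2 (m n : ℝ) (hm : m < 0) (hmn : m < n) (k₀ D R₀ C₀ : ℝ) (hk₀ : 0 ≤ k₀) (hD : 0 ≤ D)
    (hR₀ : 0 ≤ R₀) (hC₀ : 0 ≤ C₀) :
    ∃ C > (0 : ℝ), ∀ ε ∈ Ioc (0 : ℝ) 1, ∀ T ≤ 0, ∀ (y y' V R q : ℝ → ℝ),
      (∀ t, HasDerivAt y (y' t) t) →
      (∀ t, HasDerivAt y' ((-(V t * y t) - R t * (q t + y t)) + (m + n) * y' t - m * n * y t) t) →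
      (∀ t ≤ 0, |V t| ≤ k₀ * Real.exp (2 * t)) → (∀ t ≤ 0, |q t| ≤ R₀ * Real.exp (m * t)) →
      (∀ t ∈ Icc T 0, |R t| ≤ D * ε * Real.exp (m * (t - T))) →
      |y 0| + |y' 0| ≤ C₀ * ε →
      ∀ t ∈ Icc T 0, |y t| + |y' t| ≤ C * ε * Real.exp (m * t) := by
  obtain ⟨K, hK, k, hk, hcore⟩ := aux_core m n hm hmn
  refine ⟨K * (C₀ + 1) * Real.exp (k * (k₀ + D * (R₀ + 1))), by positivity, ?_⟩
  intro ε hε T hT y y' V R q hy hy' hV hq hR h0 t ht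
  have hε0 := hε.1
  have key := hcore y y' _ t k₀ (D * (R₀ + 1)) ε ht.2 hk₀ (by positivity) hε0 hy hy' ?_
  · refine key.trans ?_
    calc _ ≤ K * (C₀ * ε + ε) * Real.exp (k * (k₀ + D * (R₀ + 1))) * Real.exp (m * t) := by gcongr
      _ = _ := by ring
  · intro u hu
    have hu0 : u ≤ 0 := hu.2.le
    have he : Real.exp (m * (u - T)) ≤ Real.exp (m * (u - t)) := by
      apply Real.exp_le_exp.2
      nlinarith [ht.1]
    have a1 : |V u * y u| ≤ k₀ * Real.exp (2 * u) * |y u| := by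
      rw [abs_mul]; gcongr; exact hV u hu0
    have a2 : |R u * (q u + y u)| ≤ D * ε * Real.exp (m * (u - t)) * (R₀ * Real.exp (m * u) + |y u|) := by
      rw [abs_mul]
      gcongr
      · exact (hR u ⟨ht.1.trans hu.1.le, hu0⟩).trans (by gcongr)
      · exact (abs_add_le _ _).trans (by gcongr; exact hq u hu0)
    have a3 : D * ε * Real.exp (m * (u - t)) * (R₀ * Real.exp (m * u) + |y u|) ≤
        D * (R₀ + 1) * Real.exp (m * (u - t)) * (|y u| + ε * Real.exp (m * u)) := by
      have : ε * (R₀ * Real.exp (m * u) + |y u|) ≤ (R₀ + 1) * (|y u| + ε * Real.exp (m * u)) := by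
        have : ε * |y u| ≤ 1 * |y u| := by gcongr; exact hε.2
        have : 0 ≤ R₀ * |y u| := by positivity
        have : 0 ≤ ε * Real.exp (m * u) := by positivity
        nlinarith
      calc _ = D * Real.exp (m * (u - t)) * (ε * (R₀ * Real.exp (m * u) + |y u|)) := by ring
        _ ≤ D * Real.exp (m * (u - t)) * ((R₀ + 1) * (|y u| + ε * Real.exp (m * u))) := by gcongr
        _ = _ := by ring
    have tri : |(-(V u * y u) - R u * (q u + y u))| ≤ |V u * y u| + |R u * (q u + y u)| := by
      refine (abs_sub _ _).trans ?_
      rw [abs_neg]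
    have p2 : 0 ≤ k₀ * Real.exp (2 * u) * (ε * Real.exp (m * u)) := by positivity
    nlinarith

theorem aux_bound (g h : ℝ → ℝ) (hg : Continuous g) (hh : Continuous h) (hpos : ∀ t, 0 < h t)
    (hO : g =O[atBot] h) : ∃ C > (0 : ℝ), ∀ t ≤ 0, |g t| ≤ C * h t := by
  obtain ⟨C, hC, hb⟩ := hO.exists_pos
  rw [isBigOWith_iff] at hb
  obtain ⟨N, hN⟩ := eventually_atBot.1 hb
  obtain ⟨C', hC'⟩ := (isCompact_Icc (a := N) (b := 0)).exists_bound_of_continuousOn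
    (f := fun t => g t / h t) (hg.div hh fun t => (hpos t).ne').continuousOn
  refine ⟨max C C', lt_max_of_lt_left hC, fun t ht => ?_⟩
  have hp := hpos t
  rcases le_total t N with h1 | h1
  · have := hN t h1
    rw [Real.norm_eq_abs, Real.norm_eq_abs, abs_of_pos hp] at this
    exact this.trans (by gcongr; exact le_max_left _ _)
  · have := hC' t ⟨h1, ht⟩
    rw [Real.norm_eq_abs, abs_div, abs_of_pos hp, div_le_iff₀ hp] at this
    exact this.trans (by gcongr; exact le_max_right _ _)

/-- Interpolation at `0`. -/
theorem aux_zero (w w' g : ℝ → ℝ) (A X Y : ℝ) (hA : 0 ≤ A)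
    (hw : ∀ t, HasDerivAt w (w' t) t) (hw' : ∀ t, HasDerivAt w' (g t - A * w' t) t)
    (hX : ∀ t ∈ Icc (0:ℝ) 1, |w t| ≤ X) (hY : ∀ t ∈ Icc (0:ℝ) 1, |g t| ≤ Y) :
    |w' 0| ≤ 2 * X + 2 * A * X + Y := by
  obtain ⟨ξ, hξ, e1⟩ := exists_hasDerivAt_eq_slope w w' (zero_lt_one (α := ℝ))
    (fun t _ => (hw t).continuousAt.continuousWithinAt) (fun t _ => hw t)
  have dd : ∀ t, HasDerivAt (fun t => w' t + A * w t) (g t) t := fun t =>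
    ((hw' t).add ((hw t).const_mul A)).congr_deriv (by ring)
  obtain ⟨ζ, hζ, e2⟩ := exists_hasDerivAt_eq_slope (fun t => w' t + A * w t) g hξ.1
    (fun t _ => (dd t).continuousAt.continuousWithinAt) (fun t _ => dd t)
  have hY' := hY ζ ⟨hζ.1.le, hζ.2.le.trans hξ.2.le⟩
  have h0 := abs_le.1 (hX 0 (by simp))
  have h1 := abs_le.1 (hX 1 (by simp))
  have h2 := abs_le.1 (hX ξ ⟨hξ.1.le, hξ.2.le⟩)
  rw [sub_zero, eq_div_iff hξ.1.ne'] at e2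
  have hY0 : 0 ≤ Y := (abs_nonneg _).trans hY'
  have hgξ : |g ζ * ξ| ≤ Y := by
    rw [abs_mul, abs_of_pos hξ.1]
    have := hξ.2.le
    have := hξ.1.le
    calc _ ≤ Y * 1 := by gcongr
         _ = Y := mul_one _
  have h3 := abs_le.1 hgξ
  have e3 : w' 0 = w 1 - w 0 + A * w ξ - A * w 0 - g ζ * ξ := by
    have : w' ξ = w 1 - w 0 := by rw [e1]; simp
    linarith
  rw [abs_le]
  have q1 : A * w ξ ≤ A * X := by gcongr; exact h2.2
  have q2 : A * (-X) ≤ A * w ξ := by gcongr; exact h2.1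
  have q3 : A * w 0 ≤ A * X := by gcongr; exact h0.2
  have q4 : A * (-X) ≤ A * w 0 := by gcongr; exact h0.1
  constructor <;> linarith [h0.1, h0.2, h1.1, h1.2]

set_option maxHeartbeats 2000000 in
/-- Lemma 4.1 (Lemma `lemma:part_c_Psi_c_est` in the paper): the derivative
`ρ_{λ,c} = ∂_c Ψ_{λ,c}` stays close to `ρ_∞ = ∂_c Ψ_∞` on `[(a-1)log b, 0]`
when `(λ,c)` is close to `(λ_∞, c_∞)`. -/
theorem stmt_4 (d : ℤ) (hd : 13 ≤ d) (a : ℝ) (ha : a ∈ Set.Ioo (0 : ℝ) 1)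
    (lamInf cInf : ℝ) (ΨInf : ℝ → ℝ) (Ψ ρ : ℝ → ℝ → ℝ → ℝ)
    (hΨInfC : ContDiff ℝ 2 ΨInf)
    (hΨInfEq : ∀ t : ℝ, deriv (deriv ΨInf) t + ((d : ℝ) - 4) * deriv ΨInf t
      + (3 - (d : ℝ)) * ΨInf t + (ΨInf t) ^ 3
      = -lamInf * Real.exp (2 * t) * ΨInf t + Real.exp (4 * t) * ΨInf t)
    (hΨInfAsym : (fun t : ℝ => ΨInf t
        - Real.sqrt ((d : ℝ) - 3) * (1 - lamInf * (4 * (d : ℝ) - 10)⁻¹ * Real.exp (2 * t)))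
      =O[atBot] fun t : ℝ => Real.exp (4 * t))
    (U : Set (ℝ × ℝ)) (hU : U ∈ 𝓝 ((lamInf, cInf) : ℝ × ℝ))
    (C₁ : ℝ) (hC₁ : 0 < C₁)
    (hfam : ∀ p ∈ U,
      ContDiff ℝ 2 (Ψ p.1 p.2) ∧
      (∀ t : ℝ, deriv (deriv (Ψ p.1 p.2)) t + ((d : ℝ) - 4) * deriv (Ψ p.1 p.2) t
        + (3 - (d : ℝ)) * Ψ p.1 p.2 t + (Ψ p.1 p.2 t) ^ 3
        = -p.1 * Real.exp (2 * t) * Ψ p.1 p.2 t + Real.exp (4 * t) * Ψ p.1 p.2 t) ∧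
      (∀ t : ℝ, HasDerivAt (fun c' => Ψ p.1 c' t) (ρ p.1 p.2 t) p.2) ∧
      ContDiff ℝ 2 (ρ p.1 p.2) ∧
      (∀ t : ℝ, deriv (deriv (ρ p.1 p.2)) t + ((d : ℝ) - 4) * deriv (ρ p.1 p.2) t
        + (3 - (d : ℝ)) * ρ p.1 p.2 t + 3 * (Ψ p.1 p.2 t) ^ 2 * ρ p.1 p.2 t
        + p.1 * Real.exp (2 * t) * ρ p.1 p.2 t - Real.exp (4 * t) * ρ p.1 p.2 t = 0) ∧
      (∀ t ≥ (0 : ℝ), |Ψ p.1 p.2 t - ΨInf t| + |ρ p.1 p.2 t - ρ lamInf cInf t|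
          + |deriv (ρ p.1 p.2) t - deriv (ρ lamInf cInf) t|
        ≤ C₁ * (|p.1 - lamInf| + |p.2 - cInf|)))
    (LInf : ℝ) (hLInf : LInf ≠ 0)
    (hρInfAsym : (fun t : ℝ => ρ lamInf cInf t - LInf * Real.exp (kappam d * t))
      =O[atBot] fun t : ℝ => Real.exp (kappap d * t) + Real.exp ((kappam d + 2) * t)) :
    ∃ b₀ > (0 : ℝ), ∃ C₀ > (0 : ℝ), ∃ ε₀ > (0 : ℝ), ∀ ε ∈ Set.Ioo (0 : ℝ) ε₀,
      ∀ b ≥ b₀, ∀ lam c : ℝ,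
        |lam - lamInf| + |c - cInf| ≤ ε * b ^ (kappam d * (1 - a)) →
        ∀ t ∈ Set.Icc ((a - 1) * Real.log b) (0 : ℝ),
          |ρ lam c t - ρ lamInf cInf t| + |deriv (ρ lam c) t - deriv (ρ lamInf cInf) t|
            ≤ C₀ * ε * Real.exp (kappam d * t) := by
  have hd' : (13 : ℝ) ≤ (d : ℝ) := by exact_mod_cast hd
  set D0 : ℝ := (d : ℝ) with hD0
  set m := kappam d with hm_def
  set n := kappap d with hn_def
  have hdisc : 0 < D0 ^ 2 - 16 * D0 + 40 := by nlinarith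
  have hsq := Real.sq_sqrt hdisc.le
  have hsqp := Real.sqrt_pos.2 hdisc
  have hsum : m + n = -(D0 - 4) := by
    rw [hm_def, hn_def, kappam, kappap]; ring
  have hprod : m * n = 2 * (D0 - 3) := by
    rw [hm_def, hn_def, kappam, kappap, ← hD0]
    linear_combination (-1 / 4) * hsq
  have hmn : m < n := by
    rw [hm_def, hn_def, kappam, kappap, ← hD0]; linarith
  have hm : m < 0 := by
    rw [hm_def, kappam, ← hD0]; linarith
  clear_value m n
  set s := Real.sqrt (D0 - 3) with hs_def
  have hs2 : s ^ 2 = D0 - 3 := Real.sq_sqrt (by linarith)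
  have hs0 : 0 ≤ s := Real.sqrt_nonneg _
  have hΨc : Continuous ΨInf := hΨInfC.continuous
  have hderiv : ∀ g : ℝ → ℝ, ContDiff ℝ 2 g →
      (∀ t, HasDerivAt g (deriv g t) t) ∧ (∀ t, HasDerivAt (deriv g) (deriv (deriv g) t) t) := by
    intro g hg
    have h2 : ContDiff ℝ 1 (deriv g) := by
      have : ContDiff ℝ (1 + 1) g := by simpa [one_add_one_eq_two] using hg
      exact (contDiff_succ_iff_deriv.1 this).2.2
    exact ⟨fun t => (hg.differentiable (by norm_num) t).hasDerivAt,
      fun t => (h2.differentiable (by norm_num) t).hasDerivAt⟩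
  -- bounds for `ΨInf`
  obtain ⟨Ca, hCa, hbd⟩ := aux_bound _ _ (by fun_prop) (by fun_prop) (fun t => Real.exp_pos _) hΨInfAsym
  have h42 : ∀ t ≤ (0:ℝ), Real.exp (4 * t) ≤ Real.exp (2 * t) := fun t ht =>
    Real.exp_le_exp.2 (by linarith)
  have h21 : ∀ t ≤ (0:ℝ), Real.exp (2 * t) ≤ 1 := fun t ht => Real.exp_le_one_iff.2 (by linarith)
  set q0 := s * (lamInf * (4 * D0 - 10)⁻¹) with hq0
  set Cb := Ca + |q0| with hCb
  have hCb0 : 0 < Cb := by positivity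
  have hΨs : ∀ t ≤ (0:ℝ), |ΨInf t - s| ≤ Cb * Real.exp (2 * t) := by
    intro t ht
    have e : ΨInf t - s = (ΨInf t - s * (1 - lamInf * (4 * D0 - 10)⁻¹ * Real.exp (2 * t)))
      - q0 * Real.exp (2 * t) := by rw [hq0]; ring
    rw [e]
    refine (abs_sub _ _).trans ?_
    rw [abs_mul q0, abs_of_pos (Real.exp_pos _), hCb, add_mul]
    have := hbd t ht
    have := mul_le_mul_of_nonneg_left (h42 t ht) hCa.le
    gcongr
    linarith
  set B := Cb + s with hB
  have hB0 : 0 ≤ B := by positivity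
  have hΨB : ∀ t ≤ (0:ℝ), |ΨInf t| ≤ B := by
    intro t ht
    have e : ΨInf t = (ΨInf t - s) + s := by ring
    rw [e]
    refine (abs_add_le _ _).trans ?_
    rw [abs_of_nonneg hs0, hB]
    have := hΨs t ht
    have := mul_le_mul_of_nonneg_left (h21 t ht) hCb0.le
    linarith
  set V : ℝ → ℝ := fun t => 3 * ΨInf t ^ 2 - 3 * (D0 - 3) + lamInf * Real.exp (2 * t) - Real.exp (4 * t)
    with hV
  have hVc : Continuous V := by simp only [hV]; fun_prop
  set k₀ := 3 * Cb * (B + s) + |lamInf| + 1 with hk₀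
  have hk₀0 : 0 ≤ k₀ := by positivity
  have hVb : ∀ t ≤ (0:ℝ), |V t| ≤ k₀ * Real.exp (2 * t) := by
    intro t ht
    have e : V t = 3 * ((ΨInf t - s) * (ΨInf t + s)) + lamInf * Real.exp (2 * t) - Real.exp (4 * t) := by
      simp only [hV]; rw [← hs2]; ring
    rw [e]
    refine (abs_sub _ _).trans ?_
    have h1 := abs_add_le (3 * ((ΨInf t - s) * (ΨInf t + s))) (lamInf * Real.exp (2 * t))
    have h2 : |3 * ((ΨInf t - s) * (ΨInf t + s))| ≤ 3 * ((Cb * Real.exp (2 * t)) * (B + s)) := by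
      rw [abs_mul, abs_mul, abs_of_pos (by norm_num : (0:ℝ) < 3)]
      gcongr
      · exact hΨs t ht
      · refine (abs_add_le _ _).trans ?_
        rw [abs_of_nonneg hs0]
        linarith [hΨB t ht]
    rw [abs_mul lamInf, abs_of_pos (Real.exp_pos _)] at h1
    rw [abs_of_pos (Real.exp_pos (4 * t)), hk₀]
    linarith [h42 t ht]
  -- bounds on `[0,1]`
  obtain ⟨B1, hB1⟩ := (isCompact_Icc (a := (0:ℝ)) (b := 1)).exists_bound_of_continuousOn hΨc.continuousOn
  obtain ⟨k1, hk1⟩ := (isCompact_Icc (a := (0:ℝ)) (b := 1)).exists_bound_of_continuousOn hVc.continuousOn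
  simp only [Real.norm_eq_abs] at hB1 hk1
  have hB10 : 0 ≤ B1 := (abs_nonneg _).trans (hB1 0 (by simp))
  have hk10 : 0 ≤ k1 := (abs_nonneg _).trans (hk1 0 (by simp))
  obtain ⟨hΨd, hΨd'⟩ := hderiv ΨInf hΨInfC
  have hwd : ∀ p ∈ U, ∀ t, HasDerivAt (fun t => Ψ p.1 p.2 t - ΨInf t)
      (deriv (Ψ p.1 p.2) t - deriv ΨInf t) t := by
    intro p hp t
    exact ((hderiv _ (hfam p hp).1).1 t).sub (hΨd t)
  have hwd' : ∀ p ∈ U, ∀ t, HasDerivAt (fun t => deriv (Ψ p.1 p.2) t - deriv ΨInf t)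
      ((-(V t * (Ψ p.1 p.2 t - ΨInf t)) - 3 * ΨInf t * (Ψ p.1 p.2 t - ΨInf t) ^ 2
        - (Ψ p.1 p.2 t - ΨInf t) ^ 3
        - (p.1 - lamInf) * Real.exp (2 * t) * (ΨInf t + (Ψ p.1 p.2 t - ΨInf t)))
        + (m + n) * (deriv (Ψ p.1 p.2) t - deriv ΨInf t) - m * n * (Ψ p.1 p.2 t - ΨInf t)) t := by
    intro p hp t
    refine (((hderiv _ (hfam p hp).1).2 t).sub (hΨd' t)).congr_deriv ?_
    rw [hsum, hprod]
    simp only [hV]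
    linear_combination (hfam p hp).2.1 t - hΨInfEq t
  -- data at zero
  set Y := k1 * C₁ + 3 * B1 * C₁ ^ 2 + C₁ ^ 3 + Real.exp 2 * (B1 + C₁) + 2 * (D0 - 3) * C₁ with hY
  have hD3 : 0 ≤ 2 * (D0 - 3) := by linarith
  have hY0 : 0 ≤ Y := by positivity
  set C2 := C₁ + (2 * C₁ + 2 * (D0 - 4) * C₁ + Y) with hC2
  have hD4 : 0 ≤ D0 - 4 := by linarith
  have hC20 : 0 ≤ C2 := by positivity
  have hzero : ∀ p ∈ U, ∀ δ : ℝ, |p.1 - lamInf| + |p.2 - cInf| ≤ δ → δ ≤ 1 →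
      |Ψ p.1 p.2 0 - ΨInf 0| + |deriv (Ψ p.1 p.2) 0 - deriv ΨInf 0| ≤ C2 * δ := by
    intro p hp δ hδ hδ1
    have hδ0 : 0 ≤ δ := le_trans (by positivity) hδ
    have hl : |p.1 - lamInf| ≤ δ := by linarith [abs_nonneg (p.2 - cInf)]
    have hw : ∀ t ≥ (0:ℝ), |Ψ p.1 p.2 t - ΨInf t| ≤ C₁ * δ := by
      intro t ht
      have h1 := (hfam p hp).2.2.2.2.2 t ht
      have h2 := mul_le_mul_of_nonneg_left hδ hC₁.le
      linarith [abs_nonneg (ρ p.1 p.2 t - ρ lamInf cInf t),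
        abs_nonneg (deriv (ρ p.1 p.2) t - deriv (ρ lamInf cInf) t)]
    have hz := aux_zero (fun t => Ψ p.1 p.2 t - ΨInf t) (fun t => deriv (Ψ p.1 p.2) t - deriv ΨInf t)
      (fun t => -(V t * (Ψ p.1 p.2 t - ΨInf t)) - 3 * ΨInf t * (Ψ p.1 p.2 t - ΨInf t) ^ 2
        - (Ψ p.1 p.2 t - ΨInf t) ^ 3
        - (p.1 - lamInf) * Real.exp (2 * t) * (ΨInf t + (Ψ p.1 p.2 t - ΨInf t))
        - 2 * (D0 - 3) * (Ψ p.1 p.2 t - ΨInf t)) (D0 - 4) (C₁ * δ) (Y * δ) hD4 (hwd p hp)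
      (fun t => (hwd' p hp t).congr_deriv (by rw [hsum, hprod]; ring)) (fun t ht => hw t ht.1) ?_
    · have h1 := hw 0 le_rfl
      rw [hC2]
      linarith
    · intro t ht
      have hwt := hw t ht.1
      set x := Ψ p.1 p.2 t - ΨInf t
      have hx1 : |x| ≤ C₁ := hwt.trans (mul_le_of_le_one_right hC₁.le hδ1)
      have a1 : |V t * x| ≤ k1 * (C₁ * δ) := by
        rw [abs_mul]; gcongr; exact hk1 t ht
      have a2 : |3 * ΨInf t * x ^ 2| ≤ 3 * B1 * (C₁ * (C₁ * δ)) := by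
        rw [abs_mul, abs_mul, abs_pow, abs_of_pos (by norm_num : (0:ℝ) < 3), pow_two]
        gcongr; exact hB1 t ht
      have a3 : |x ^ 3| ≤ C₁ * (C₁ * (C₁ * δ)) := by
        rw [abs_pow, pow_three]; gcongr
      have a4 : |(p.1 - lamInf) * Real.exp (2 * t) * (ΨInf t + x)| ≤ δ * Real.exp 2 * (B1 + C₁) := by
        rw [abs_mul, abs_mul, abs_of_pos (Real.exp_pos _)]
        gcongr
        · linarith [ht.2]
        · exact (abs_add_le _ _).trans (add_le_add (hB1 t ht) hx1)
      have a5 : |2 * (D0 - 3) * x| ≤ 2 * (D0 - 3) * (C₁ * δ) := by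
        rw [abs_mul, abs_of_nonneg hD3]; gcongr
      have t1 := abs_sub (-(V t * x) - 3 * ΨInf t * x ^ 2 - x ^ 3
        - (p.1 - lamInf) * Real.exp (2 * t) * (ΨInf t + x)) (2 * (D0 - 3) * x)
      have t2 := abs_sub (-(V t * x) - 3 * ΨInf t * x ^ 2 - x ^ 3)
        ((p.1 - lamInf) * Real.exp (2 * t) * (ΨInf t + x))
      have t3 := abs_sub (-(V t * x) - 3 * ΨInf t * x ^ 2) (x ^ 3)
      have t4 := abs_sub (-(V t * x)) (3 * ΨInf t * x ^ 2)
      rw [abs_neg] at t4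
      rw [hY]
      linarith
  have hp0 : ((lamInf, cInf) : ℝ × ℝ) ∈ U := mem_of_mem_nhds hU
  obtain ⟨M, hM, ε₁, hε₁, hst1⟩ := aux_step1 m n hm hmn k₀ B C2 hk₀0 hB0 hC20
  have hS1 : ∀ ε ∈ Ioo 0 ε₁, ε ≤ 1 → ∀ T ≤ 0, ∀ p ∈ U,
      |p.1 - lamInf| + |p.2 - cInf| ≤ ε * Real.exp (-m * T) → ∀ t ∈ Icc T 0,
      |Ψ p.1 p.2 t - ΨInf t| ≤ M * ε * Real.exp (m * (t - T)) ∧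
        M * ε * Real.exp (m * (t - T)) ≤ 1 := by
    intro ε hε hε1 T hT p hp hδ
    refine hst1 ε hε T hT _ _ V ΨInf (p.1 - lamInf) (hwd p hp) (hwd' p hp) hVb hΨB ?_ ?_
    · linarith [abs_nonneg (p.2 - cInf)]
    · refine hzero p hp _ hδ ?_
      have : Real.exp (-m * T) ≤ 1 := Real.exp_le_one_iff.2
        (mul_nonpos_of_nonneg_of_nonpos (by linarith) hT)
      exact mul_le_one₀ hε1 (Real.exp_pos _).le this
  have hΨeq : ∀ t, Ψ lamInf cInf t = ΨInf t := by
    intro t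
    rcases le_total 0 t with ht | ht
    · have h1 := (hfam _ hp0).2.2.2.2.2 t ht
      simp only [sub_self, abs_zero, add_zero, mul_zero] at h1
      exact sub_eq_zero.1 (abs_nonpos_iff.1 h1)
    · apply sub_eq_zero.1
      apply abs_nonpos_iff.1
      apply le_of_forall_pos_le_add
      intro e he
      set ε := min (min (ε₁ / 2) 1) (e / M) with hεd
      have hε0 : 0 < ε := by positivity
      have hε1 : ε ≤ ε₁ / 2 := (min_le_left _ _).trans (min_le_left _ _)
      have hε2 : ε ≤ 1 := (min_le_left _ _).trans (min_le_right _ _)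
      have hε3 : ε ≤ e / M := min_le_right _ _
      have := (hS1 ε ⟨hε0, by linarith⟩ hε2 t ht (lamInf, cInf) hp0
        (by simp only [sub_self, abs_zero, add_zero]; positivity) t ⟨le_rfl, ht⟩).1
      simp only [sub_self, mul_zero, Real.exp_zero, mul_one] at this
      rw [le_div_iff₀ hM] at hε3
      linarith
  -- bound for `ρ_∞`
  have hρc : ContDiff ℝ 2 (ρ lamInf cInf) := (hfam _ hp0).2.2.2.1
  have hρO : (ρ lamInf cInf) =O[atBot] fun t : ℝ => Real.exp (m * t) := by
    have h1 : (fun t : ℝ => Real.exp (n * t) + Real.exp ((m + 2) * t)) =O[atBot]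
        fun t : ℝ => Real.exp (m * t) := by
      apply IsBigO.of_bound 2
      filter_upwards [eventually_le_atBot (0:ℝ)] with t ht
      rw [Real.norm_eq_abs, Real.norm_eq_abs, abs_of_pos (Real.exp_pos _), abs_of_pos (by positivity)]
      have a1 : Real.exp (n * t) ≤ Real.exp (m * t) := Real.exp_le_exp.2 (by nlinarith)
      have a2 : Real.exp ((m + 2) * t) ≤ Real.exp (m * t) := Real.exp_le_exp.2 (by nlinarith)
      linarith
    have h2 := (hρInfAsym.trans h1).add
      ((isBigO_refl (fun t : ℝ => Real.exp (m * t)) atBot).const_mul_left LInf)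
    simpa using h2
  obtain ⟨R₀, hR₀, hρb⟩ := aux_bound _ _ hρc.continuous (by fun_prop) (fun t => Real.exp_pos _) hρO
  obtain ⟨C, hC, hst2⟩ := aux_step2 m n hm hmn k₀ (3 * M * (2 * B + 1) + 1) R₀ C₁ hk₀0
    (by positivity) hR₀.le hC₁.le
  obtain ⟨r, hr, hball⟩ := Metric.mem_nhds_iff.1 hU
  refine ⟨1, one_pos, C, hC, min (min ε₁ 1) r, by positivity, ?_⟩
  intro ε hε b hb lam c hδ
  have hε0 : 0 < ε := hε.1
  have hεε₁ : ε < ε₁ := hε.2.trans_le ((min_le_left _ _).trans (min_le_left _ _))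
  have hε1 : ε ≤ 1 := hε.2.le.trans ((min_le_left _ _).trans (min_le_right _ _))
  have hεr : ε < r := hε.2.trans_le (min_le_right _ _)
  set T := (a - 1) * Real.log b with hT
  have hT0 : T ≤ 0 := mul_nonpos_of_nonpos_of_nonneg (by linarith [ha.2]) (Real.log_nonneg hb)
  have hbT : b ^ (m * (1 - a)) = Real.exp (-m * T) := by
    rw [Real.rpow_def_of_pos (by linarith), hT]; congr 1; ring
  rw [hbT] at hδ
  have hE1 : Real.exp (-m * T) ≤ 1 := Real.exp_le_one_iff.2
        (mul_nonpos_of_nonneg_of_nonpos (by linarith) hT0)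
  have hδε : |lam - lamInf| + |c - cInf| ≤ ε := by
    refine hδ.trans ?_
    exact mul_le_of_le_one_right hε0.le hE1
  have hp : ((lam, c) : ℝ × ℝ) ∈ U := by
    apply hball
    rw [Metric.mem_ball, Prod.dist_eq, max_lt_iff, Real.dist_eq, Real.dist_eq]
    constructor
    · linarith [abs_nonneg (c - cInf)]
    · linarith [abs_nonneg (lam - lamInf)]
  obtain ⟨-, -, -, hρC, hρE, hbnd⟩ := hfam _ hp
  have hρE0 := (hfam _ hp0).2.2.2.2.1
  simp only at hρC hρE hbnd hρE0
  have hw1 := hS1 ε ⟨hε0, hεε₁⟩ hε1 T hT0 (lam, c) hp hδ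
  simp only at hw1
  refine hst2 ε ⟨hε0, hε1⟩ T hT0 (fun t => ρ lam c t - ρ lamInf cInf t)
    (fun t => deriv (ρ lam c) t - deriv (ρ lamInf cInf) t) V
    (fun t => 3 * (Ψ lam c t ^ 2 - ΨInf t ^ 2) + (lam - lamInf) * Real.exp (2 * t))
    (ρ lamInf cInf) (fun t => ((hderiv _ hρC).1 t).sub ((hderiv _ hρc).1 t)) ?_ hVb hρb ?_ ?_
  · intro t
    refine (((hderiv _ hρC).2 t).sub ((hderiv _ hρc).2 t)).congr_deriv ?_
    rw [hsum, hprod]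
    simp only [hV]
    have h0 := hρE0 t
    rw [hΨeq t] at h0
    linear_combination hρE t - h0
  · intro t ht
    obtain ⟨h1, h2⟩ := hw1 t ht
    have h3 : |3 * (Ψ lam c t ^ 2 - ΨInf t ^ 2)| ≤
        3 * ((M * ε * Real.exp (m * (t - T))) * (2 * B + 1)) := by
      have e : Ψ lam c t ^ 2 - ΨInf t ^ 2 =
          (Ψ lam c t - ΨInf t) * (2 * ΨInf t + (Ψ lam c t - ΨInf t)) := by ring
      rw [e, abs_mul, abs_mul, abs_of_pos (by norm_num : (0:ℝ) < 3)]
      gcongr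
      refine (abs_add_le _ _).trans ?_
      rw [abs_mul, abs_of_pos (by norm_num : (0:ℝ) < 2)]
      linarith [hΨB t ht.2]
    have h4 : |(lam - lamInf) * Real.exp (2 * t)| ≤ ε * Real.exp (m * (t - T)) := by
      rw [abs_mul, abs_of_pos (Real.exp_pos _)]
      have e1 : |lam - lamInf| ≤ ε * Real.exp (-m * T) := by linarith [abs_nonneg (c - cInf)]
      have e2 : Real.exp (2 * t) ≤ Real.exp (m * t) := (h21 t ht.2).trans
        (Real.one_le_exp (mul_nonneg_of_nonpos_of_nonpos hm.le ht.2))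
      calc _ ≤ (ε * Real.exp (-m * T)) * Real.exp (m * t) := by gcongr
        _ = _ := by rw [mul_assoc, ← Real.exp_add]; congr 2; ring
    refine (abs_add_le _ _).trans ?_
    linarith
  · have h1 := hbnd 0 le_rfl
    have h2 := mul_le_mul_of_nonneg_left hδε hC₁.le
    linarith [abs_nonneg (Ψ lam c 0 - ΨInf 0)]
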